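/- The limit as n → ∞ of ∑_{i=1}^∞ db(n,2i) equals 1/4 (for each n the series ∑_{i=1}^∞ db(n,2i) converges). -/

import Mathlib

open scoped Classical

/-- A deal of size `n` is a fixed-point-free involution of `Fin (2*n)`. -/
def IsDeal (n : ℕ) (π : Fin (2*n) → Fin (2*n)) : Prop :=
  ∀ j, π (π j) = j ∧ π j ≠ j

/-- The finite set `D_n` of all deals of size `n`. -/
noncomputable def deals (n : ℕ) : Finset (Fin (2*n) → Fin (2*n)) :=
  Finset.univ.filter (IsDeal n)

/-- The second occurrences of `π` (positions `j` with `π j < j`), in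
increasing order: `j_1 < j_2 < ... < j_n`. -/
def blockEnds {n : ℕ} (π : Fin (2*n) → Fin (2*n)) : List (Fin (2*n)) :=
  (Finset.univ.filter (fun j => π j < j)).sort (· ≤ ·)

/-- The block lengths `b_1, ..., b_n` of a deal:
`b_1 = j_1 + 1` and `b_i = j_i - j_(i-1)` for `i ≥ 2`. -/
def blockLens {n : ℕ} (π : Fin (2*n) → Fin (2*n)) : List ℕ :=
  List.zipWith (fun x y => x - y)
    ((blockEnds π).map (fun j => (j : ℕ) + 1))
    (0 :: (blockEnds π).map (fun j => (j : ℕ) + 1))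

/-- The blocks of a deal: each block length `b_i` paired with the ending
position `j_i` of the block. -/
def blocks {n : ℕ} (π : Fin (2*n) → Fin (2*n)) : List (ℕ × Fin (2*n)) :=
  List.zip (blockLens π) (blockEnds π)

/-- The `i`-th block (ending at position `j_i`) is lucky if `π j_i = j_i - 1`. -/
def IsLuckyEnd {n : ℕ} (π : Fin (2*n) → Fin (2*n)) (j : Fin (2*n)) : Prop :=
  (π j).val = (j : ℕ) - 1

/-- `b(n,j)`: total number of blocks of length `j` over all deals in `D_n`. -/
noncomputable def bcount (n j : ℕ) : ℕ :=
  ∑ π ∈ deals n, (blockLens π).count j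

/-- `l(n,j)`: total number of lucky blocks of length `j` over all deals in `D_n`. -/
noncomputable def lcount (n j : ℕ) : ℕ :=
  ∑ π ∈ deals n, (blocks π).countP (fun p => decide (p.1 = j ∧ IsLuckyEnd π p.2))

/-- `eb(n,j)`: the expected number of blocks of length `j` in a random deal. -/
noncomputable def eb (n j : ℕ) : ℝ := (bcount n j : ℝ) / ((deals n).card : ℝ)

/-- `el(n,j)`: the expected number of lucky blocks of length `j` in a random deal. -/
noncomputable def el (n j : ℕ) : ℝ := (lcount n j : ℝ) / ((deals n).card : ℝ)

/-- `db(n,j) = eb(n,j) - 2(2n+1)/(j(j+1)(j+2))`. -/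
noncomputable def db (n j : ℕ) : ℝ :=
  eb n j - 2*(2*(n:ℝ)+1) / ((j:ℝ) * ((j:ℝ)+1) * ((j:ℝ)+2))

/-- `dl(n,j) = el(n,j) - 1/(j(j-1))`. -/
noncomputable def dl (n j : ℕ) : ℝ :=
  el n j - 1 / ((j:ℝ) * ((j:ℝ)-1))

/-- `e(π)`: the number of blocks of `π` of even length. -/
noncomputable def evenBlocks {n : ℕ} (π : Fin (2*n) → Fin (2*n)) : ℕ :=
  (blockLens π).countP (fun b => decide (Even b))

/-- `l(π)`: the number of even-length lucky blocks of `π`. -/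
noncomputable def luckyEvenBlocks {n : ℕ} (π : Fin (2*n) → Fin (2*n)) : ℕ :=
  (blocks π).countP (fun p => decide (Even p.1 ∧ IsLuckyEnd π p.2))

/-- The fixed-point-free involutions of `α` that map `K` into `R`. -/
noncomputable def matchingsInto {α : Type*} [Fintype α] (K R : Finset α) : Finset (α → α) :=
  Finset.univ.filter fun π => (∀ j, π (π j) = j ∧ π j ≠ j) ∧ ∀ q ∈ K, π q ∈ R

lemma mem_matchingsInto {α : Type*} [Fintype α] {K R : Finset α} {π : α → α} :
    π ∈ matchingsInto K R ↔ (∀ j, π (π j) = j ∧ π j ≠ j) ∧ ∀ q ∈ K, π q ∈ R := by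
  simp [matchingsInto]

lemma swap_conj_matching {α : Type*} {π : α → α}
    (h : ∀ j, π (π j) = j ∧ π j ≠ j) (y z : α) (j : α) :
    Equiv.swap y z (π (Equiv.swap y z (Equiv.swap y z (π (Equiv.swap y z j))))) = j ∧
      Equiv.swap y z (π (Equiv.swap y z j)) ≠ j := by
  constructor
  · simp [(h _).1]
  · intro hj
    apply (h (Equiv.swap y z j)).2
    simpa using congrArg (Equiv.swap y z) hj

/-- The partner of a further point `x` is equidistributed over the points not yet used. -/
lemma card_matchingsInto_insert {α : Type*} [Fintype α] {K R : Finset α} {x : α}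
    (hxK : x ∉ K) (hxR : x ∉ R) (hKR : Disjoint K R) :
    ((matchingsInto (insert x K) R).card : ℝ) * (Fintype.card α - 1 - 2 * K.card) =
      (matchingsInto K R).card * (R.card - K.card) := by
  have hinj : ∀ π ∈ matchingsInto K R, Function.Injective π := fun π hπ =>
    Function.LeftInverse.injective fun j => ((mem_matchingsInto.1 hπ).1 j).1
  have hsub : ∀ π ∈ matchingsInto K R, K.image π ⊆ R := fun π hπ => by
    intro y hy
    obtain ⟨q, hq, rfl⟩ := Finset.mem_image.1 hy
    exact (mem_matchingsInto.1 hπ).2 q hq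
  have hmono : ∀ π ∈ matchingsInto (insert x K) R, π ∈ matchingsInto K R := fun π hπ => by
    rw [mem_matchingsInto] at hπ ⊢
    exact ⟨hπ.1, fun q hq => hπ.2 q (Finset.mem_insert_of_mem hq)⟩
  have hfree : ∀ π ∈ matchingsInto (insert x K) R,
      (((insert x (K ∪ K.image π))ᶜ.card : ℕ) : ℝ) = Fintype.card α - 1 - 2 * K.card := by
    intro π hπ
    have hπ' := hmono π hπ
    have h1 : (insert x (K ∪ K.image π)).card = 2 * K.card + 1 := by
      rw [Finset.card_insert_of_notMem, Finset.card_union_of_disjoint,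
        Finset.card_image_of_injective _ (hinj π hπ')]
      · ring
      · exact Finset.disjoint_of_subset_right (hsub π hπ') hKR
      · simp only [Finset.mem_union, not_or]
        exact ⟨hxK, fun h => hxR (hsub π hπ' h)⟩
    have h2 := Finset.card_add_card_compl (insert x (K ∪ K.image π))
    rw [h1] at h2
    rw [← h2]; push_cast; ring
  have hopen : ∀ π ∈ matchingsInto K R, (((R \ K.image π).card : ℕ) : ℝ) = R.card - K.card := by
    intro π hπ
    have h := Finset.card_sdiff_add_card_eq_card (hsub π hπ)
    rw [Finset.card_image_of_injective _ (hinj π hπ)] at h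
    rw [← h]; push_cast; ring
  have key : ((matchingsInto (insert x K) R).sigma
        fun π => (insert x (K ∪ K.image π))ᶜ).card =
      ((matchingsInto K R).sigma fun π => R \ K.image π).card := by
    refine Finset.card_nbij'
      (fun p => ⟨fun j => Equiv.swap (p.1 x) p.2 (p.1 (Equiv.swap (p.1 x) p.2 j)), p.1 x⟩)
      (fun p => ⟨fun j => Equiv.swap p.2 (p.1 x) (p.1 (Equiv.swap p.2 (p.1 x) j)), p.1 x⟩)
      ?_ ?_ ?_ ?_
    · rintro ⟨π, z⟩ h
      simp only [Finset.coe_sigma, Set.mem_sigma_iff, Finset.mem_coe, Finset.mem_compl,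
        Finset.mem_insert, Finset.mem_union, Finset.mem_image, not_or, not_exists, not_and,
        mem_matchingsInto, Finset.mem_sdiff] at h ⊢
      obtain ⟨⟨hπ, hR⟩, hzx, hzK, hz⟩ := h
      have hfix : ∀ q ∈ K, Equiv.swap (π x) z (π (Equiv.swap (π x) z q)) = π q := by
        intro q hq
        have h1 : q ≠ π x := fun h =>
          Finset.disjoint_left.1 hKR hq (h ▸ hR x (Or.inl rfl))
        have h2 : q ≠ z := fun h => hzK (h ▸ hq)
        have h3 : π q ≠ π x := fun h => hxK (by
          have := congrArg π h
          rw [(hπ q).1, (hπ x).1] at this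
          exact this ▸ hq)
        rw [Equiv.swap_apply_of_ne_of_ne h1 h2, Equiv.swap_apply_of_ne_of_ne h3 (hz q hq)]
      refine ⟨⟨swap_conj_matching hπ _ _, fun q hq => ?_⟩, hR x (Or.inl rfl), fun q hq h => ?_⟩
      · rw [hfix q hq]; exact hR q (Or.inr hq)
      · rw [hfix q hq] at h
        have := congrArg π h
        rw [(hπ q).1, (hπ x).1] at this
        exact hxK (this ▸ hq)
    · rintro ⟨π, y⟩ h
      simp only [Finset.coe_sigma, Set.mem_sigma_iff, Finset.mem_coe, Finset.mem_compl,
        Finset.mem_insert, Finset.mem_union, Finset.mem_image, not_or, not_exists, not_and,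
        mem_matchingsInto, Finset.mem_sdiff] at h ⊢
      obtain ⟨⟨hπ, hR⟩, hyR, hy⟩ := h
      have hxK' : π x ∉ K := fun h => hxR (by have := hR _ h; rwa [(hπ x).1] at this)
      have hfix : ∀ q ∈ K, Equiv.swap y (π x) (π (Equiv.swap y (π x) q)) = π q := by
        intro q hq
        have h1 : q ≠ y := fun h => Finset.disjoint_left.1 hKR hq (h ▸ hyR)
        have h2 : q ≠ π x := fun h => hxK' (h ▸ hq)
        have h3 : π q ≠ π x := fun h => hxK (by
          have := congrArg π h
          rw [(hπ q).1, (hπ x).1] at this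
          exact this ▸ hq)
        rw [Equiv.swap_apply_of_ne_of_ne h1 h2, Equiv.swap_apply_of_ne_of_ne (hy q hq) h3]
      have hx : Equiv.swap y (π x) (π (Equiv.swap y (π x) x)) = y := by
        rw [Equiv.swap_apply_of_ne_of_ne (a := y) (b := π x) (x := x)
          (fun h => hxR (h ▸ hyR)) (fun h => (hπ x).2 h.symm), Equiv.swap_apply_right]
      refine ⟨⟨swap_conj_matching hπ _ _, ?_⟩, (hπ x).2, hxK', fun q hq h => ?_⟩
      · rintro q (rfl | hq)
        · rw [hx]; exact hyR
        · rw [hfix q hq]; exact hR q hq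
      · rw [hfix q hq] at h
        have := congrArg π h
        rw [(hπ q).1, (hπ x).1] at this
        exact hxK (this ▸ hq)
    · rintro ⟨π, z⟩ h
      simp only [Finset.coe_sigma, Set.mem_sigma_iff, Finset.mem_coe, Finset.mem_compl,
        Finset.mem_insert, Finset.mem_union, not_or, mem_matchingsInto] at h
      obtain ⟨⟨hπ, hR⟩, hzx, -⟩ := h
      have hx : Equiv.swap (π x) z x = x :=
        Equiv.swap_apply_of_ne_of_ne (fun h => (hπ x).2 h.symm) (fun h => hzx h.symm)
      simp [hx]
    · rintro ⟨π, y⟩ h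
      simp only [Finset.coe_sigma, Set.mem_sigma_iff, Finset.mem_coe, mem_matchingsInto,
        Finset.mem_sdiff] at h
      obtain ⟨⟨hπ, hR⟩, hyR, -⟩ := h
      have hx : Equiv.swap y (π x) x = x :=
        Equiv.swap_apply_of_ne_of_ne (fun h => hxR (h ▸ hyR)) (fun h => (hπ x).2 h.symm)
      simp [hx]
  have key' := congrArg (Nat.cast : ℕ → ℝ) key
  rw [Finset.card_sigma, Finset.card_sigma, Nat.cast_sum, Nat.cast_sum,
    Finset.sum_congr rfl hfree, Finset.sum_congr rfl hopen] at key'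
  simpa only [Finset.sum_const, nsmul_eq_mul] using key'

lemma card_matchingsInto {α : Type*} [Fintype α] (K R : Finset α) (hKR : Disjoint K R) :
    ((matchingsInto K R).card : ℝ) * ∏ i ∈ Finset.range K.card, ((Fintype.card α : ℝ) - 1 - 2 * i) =
      (matchingsInto ∅ R).card * ∏ i ∈ Finset.range K.card, ((R.card : ℝ) - i) := by
  induction K using Finset.induction_on with
  | empty => simp
  | insert x K hx ih =>
    rw [Finset.disjoint_insert_left] at hKR
    rw [Finset.card_insert_of_notMem hx, Finset.prod_range_succ, Finset.prod_range_succ]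
    have := card_matchingsInto_insert hx hKR.1 hKR.2
    linear_combination (∏ i ∈ Finset.range K.card, ((Fintype.card α : ℝ) - 1 - 2 * i)) * this +
      (R.card - K.card : ℝ) * ih hKR.2

/-- In a strictly increasing list, a gap exceeds `k` iff the `k` predecessors of its right end
are missing from the list. -/
lemma countP_lt_zipWith_sub (k : ℕ) : ∀ (l : List ℕ) (a : ℕ), (a :: l).Pairwise (· < ·) →
    (List.zipWith (fun x y => x - y) l (a :: l)).countP (fun b => decide (k < b)) =
      l.countP fun e => decide (∀ q ∈ a :: l, q < e → q + k < e)
  | [], _, _ => by simp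
  | b :: l, a, h => by
    obtain ⟨ha, hb⟩ := List.pairwise_cons.1 h
    have hbl := (List.pairwise_cons.1 hb).1
    have hab := ha b (by simp)
    rw [List.zipWith_cons_cons, List.countP_cons, List.countP_cons,
      countP_lt_zipWith_sub k l b hb]
    congr 1
    · apply List.countP_congr
      intro e he
      have := hbl e he
      simp only [decide_eq_true_eq, List.mem_cons, forall_eq_or_imp]
      constructor
      · rintro ⟨h1, h2⟩; exact ⟨by omega, h1, h2⟩
      · rintro ⟨-, h1, h2⟩; exact ⟨h1, h2⟩
    · have : (k < b - a) ↔ ∀ q ∈ a :: b :: l, q < b → q + k < b := by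
        simp only [List.mem_cons, forall_eq_or_imp]
        constructor
        · intro h
          exact ⟨by omega, by omega, fun q hq hqb => absurd (hbl q hq) (by omega)⟩
        · rintro ⟨h1, -⟩; have := h1 hab; omega
      simp only [this]

lemma countP_lt_eq_count_add (k : ℕ) (l : List ℕ) :
    l.countP (fun b => decide (k < b)) =
      l.count (k + 1) + l.countP (fun b => decide (k + 1 < b)) := by
  induction l with
  | nil => simp
  | cons b l ih =>
    simp only [List.countP_cons, List.count_cons, ih, decide_eq_true_eq, beq_iff_eq]
    split_ifs <;> omega

lemma countP_sort {α : Type*} [LinearOrder α] (s : Finset α) (p : α → Prop)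
    [DecidablePred p] :
    (s.sort (· ≤ ·)).countP (fun a => decide (p a)) = (s.filter p).card := by
  rw [← Multiset.coe_countP, Finset.sort_eq, Multiset.countP_eq_card_filter]
  rfl

lemma blockLens_eq {n : ℕ} (π : Fin (2 * n) → Fin (2 * n)) :
    blockLens π = List.zipWith (fun x y => x - y)
      ((blockEnds π).map fun j : Fin (2 * n) => j.val + 1)
      (0 :: (blockEnds π).map fun j : Fin (2 * n) => j.val + 1) := by
  simp only [blockLens, bind_pure_comp, List.map_eq_map, List.map_map, Function.comp_def]

lemma countP_blockLens {n : ℕ} (π : Fin (2 * n) → Fin (2 * n)) (k : ℕ) :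
    (blockLens π).countP (fun b => decide (k < b)) =
      (Finset.univ.filter fun e : Fin (2 * n) => k ≤ (e : ℕ) ∧ π e < e ∧
        ∀ q : Fin (2 * n), π q < q → q < e → (q : ℕ) + k < e).card := by
  rw [blockLens_eq, countP_lt_zipWith_sub, List.countP_map]
  · rw [blockEnds]
    simp only [Function.comp_def]
    rw [countP_sort, Finset.filter_filter]
    congr 1
    ext e
    simp only [Finset.mem_filter, Finset.mem_univ, true_and, List.mem_cons, forall_eq_or_imp,
      List.mem_map, Finset.mem_sort, forall_exists_index, and_imp, forall_apply_eq_imp_iff₂,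
      Fin.lt_def]
    constructor
    · rintro ⟨h1, h2, h3⟩
      refine ⟨by omega, h1, fun q hq hqe => ?_⟩
      have := h3 q hq (by omega)
      omega
    · rintro ⟨h1, h2, h3⟩
      refine ⟨h2, by omega, fun q hq hqe => ?_⟩
      have := h3 q hq (by omega)
      omega
  · rw [List.pairwise_cons]
    refine ⟨by simp, ?_⟩
    rw [List.pairwise_map]
    refine (Finset.sortedLT_sort _).pairwise.imp fun {a b} h => ?_
    have := Fin.lt_def.1 h
    omega

/-- The deals for which the `k` positions from `s` on are all first occurrences. -/
noncomputable def firstsFrom (n s k : ℕ) : Finset (Fin (2 * n) → Fin (2 * n)) :=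
  (deals n).filter fun π => ∀ q : Fin (2 * n), s ≤ (q : ℕ) → (q : ℕ) < s + k → q < π q

lemma mem_deals {n : ℕ} {π : Fin (2 * n) → Fin (2 * n)} :
    π ∈ deals n ↔ ∀ j, π (π j) = j ∧ π j ≠ j := by
  simp [deals, IsDeal]

lemma deals_eq_matchingsInto (n : ℕ) (R : Finset (Fin (2 * n))) : deals n = matchingsInto ∅ R := by
  ext π
  simp [mem_matchingsInto, mem_deals]

lemma deals_nonempty (n : ℕ) : (deals n).Nonempty := by
  refine ⟨Fin.rev, mem_deals.2 fun j => ⟨Fin.rev_rev j, fun h => ?_⟩⟩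
  have := congrArg Fin.val h
  rw [Fin.val_rev] at this
  omega

lemma firstsFrom_eq_matchingsInto (n s k : ℕ) :
    firstsFrom n s k = matchingsInto
      (Finset.univ.filter fun q : Fin (2 * n) => s ≤ (q : ℕ) ∧ (q : ℕ) < s + k)
      (Finset.univ.filter fun q : Fin (2 * n) => s + k ≤ (q : ℕ)) := by
  ext π
  simp only [firstsFrom, mem_deals, mem_matchingsInto, Finset.mem_filter, Finset.mem_univ,
    true_and, and_imp]
  refine and_congr_right fun hπ => ⟨fun h q h1 h2 => ?_, fun h q h1 h2 => ?_⟩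
  · by_contra! h3
    have h4 := Fin.lt_def.1 (h q h1 h2)
    have h5 := Fin.lt_def.1 (h (π q) (by omega) (by omega))
    rw [(hπ q).1] at h5
    omega
  · have := h q h1 h2
    rw [Fin.lt_def]; omega

lemma card_filter_fin {N a b : ℕ} (hb : b ≤ N) :
    (Finset.univ.filter fun q : Fin N => a ≤ (q : ℕ) ∧ (q : ℕ) < b).card = b - a := by
  rw [← Nat.card_Ico, ← Finset.card_map Fin.valEmbedding]
  congr 1
  ext q
  simp only [Finset.mem_map, Finset.mem_filter, Finset.mem_univ, true_and, Fin.valEmbedding_apply,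
    Finset.mem_Ico]
  exact ⟨fun ⟨p, hp, h⟩ => h ▸ hp, fun h => ⟨⟨q, by omega⟩, h, rfl⟩⟩

/-- The probability that `k` given consecutive positions, followed by `r` further ones, are all
first occurrences. -/
noncomputable def firstsProb (n k : ℕ) (r : ℝ) : ℝ :=
  ∏ i ∈ Finset.range k, (r - i) / (2 * n - 1 - 2 * i)

lemma odd_sub_ne_zero (n i : ℕ) : (2 * n - 1 - 2 * i : ℝ) ≠ 0 := by
  intro h
  have : (2 * n : ℝ) = 1 + 2 * i := by linarith
  norm_cast at this
  omega

lemma card_firstsFrom {n s k : ℕ} (h : s + k ≤ 2 * n) :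
    ((firstsFrom n s k).card : ℝ) = (deals n).card * firstsProb n k (2 * n - s - k) := by
  have hR : (Finset.univ.filter fun q : Fin (2 * n) => s + k ≤ (q : ℕ)).card =
      2 * n - (s + k) := by
    rw [← card_filter_fin (le_refl (2 * n))]
    simp
  have hK := card_filter_fin (a := s) h
  rw [Nat.add_sub_cancel_left] at hK
  have := card_matchingsInto
    (Finset.univ.filter fun q : Fin (2 * n) => s ≤ (q : ℕ) ∧ (q : ℕ) < s + k)
    (Finset.univ.filter fun q : Fin (2 * n) => s + k ≤ (q : ℕ)) (by
      rw [Finset.disjoint_filter]; intros; omega)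
  rw [← firstsFrom_eq_matchingsInto, ← deals_eq_matchingsInto, hK, hR, Nat.cast_sub h,
    Fintype.card_fin] at this
  push_cast at this
  rw [firstsProb, Finset.prod_div_distrib, mul_div_assoc', eq_div_iff
    (Finset.prod_ne_zero_iff.2 fun i _ => odd_sub_ne_zero n i), this]
  simp only [sub_sub]

/-- The deals having a block of length more than `k` that ends at `s + k`. -/
lemma card_blockEnd {n s k : ℕ} (h : s + k < 2 * n) :
    (((deals n).filter fun π => k ≤ s + k ∧ π ⟨s + k, h⟩ < ⟨s + k, h⟩ ∧
        ∀ q : Fin (2 * n), π q < q → q < ⟨s + k, h⟩ → (q : ℕ) + k < s + k).card : ℝ) =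
      (firstsFrom n s k).card - (firstsFrom n s (k + 1)).card := by
  rw [eq_sub_iff_add_eq]
  norm_cast
  rw [← Finset.card_union_of_disjoint]
  · congr 1
    ext π
    simp only [Finset.mem_union, Finset.mem_filter, firstsFrom, ← and_or_left]
    refine and_congr_right fun hπ => ?_
    have hne := fun q => (mem_deals.1 hπ q).2
    constructor
    · rintro (⟨-, -, h2⟩ | h1) q hq hqk
      · refine lt_of_le_of_ne (not_lt.1 fun hlt => ?_) (hne q).symm
        have := h2 q hlt (Fin.lt_def.2 hqk)
        omega
      · exact h1 q hq (by omega)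
    · intro h1
      rcases lt_or_gt_of_ne (hne ⟨s + k, h⟩) with h2 | h2
      · refine Or.inl ⟨by omega, h2, fun q hq hqs => ?_⟩
        by_contra hlt
        exact lt_asymm hq (h1 q (by omega) (Fin.lt_def.1 hqs))
      · refine Or.inr fun q hq hqk => ?_
        rcases Nat.lt_or_ge q (s + k) with h3 | h3
        · exact h1 q hq h3
        · have : q = ⟨s + k, h⟩ := Fin.ext (by simp only; omega)
          rw [this]; exact h2
  · rw [Finset.disjoint_left]
    intro π hπ hπ'
    have h1 := (Finset.mem_filter.1 hπ).2.2.1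
    have h2 := (Finset.mem_filter.1 hπ').2 ⟨s + k, h⟩ (by simp) (by simp)
    exact lt_asymm h1 h2

lemma sum_countP_blockLens {n k M : ℕ} (h : k + M = 2 * n) :
    ((∑ π ∈ deals n, (blockLens π).countP (fun b => decide (k < b)) : ℕ) : ℝ) =
      ∑ s ∈ Finset.range M, (((firstsFrom n s k).card : ℝ) - (firstsFrom n s (k + 1)).card) := by
  simp_rw [countP_blockLens, Finset.card_filter]
  rw [Finset.sum_comm]
  simp_rw [← Finset.card_filter]
  let G : ℕ → ℝ := fun e => if k ≤ e then ((firstsFrom n (e - k) k).card : ℝ) -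
    (firstsFrom n (e - k) (k + 1)).card else 0
  have hG : ∀ e : Fin (2 * n), (((deals n).filter fun π => k ≤ (e : ℕ) ∧ π e < e ∧
        ∀ q : Fin (2 * n), π q < q → q < e → (q : ℕ) + k < e).card : ℝ) = G e := by
    rintro ⟨e, he⟩
    simp only [G]
    split_ifs with hke
    · obtain ⟨s, rfl⟩ := Nat.exists_eq_add_of_le' hke
      rw [Nat.add_sub_cancel, ← card_blockEnd he]
    · simp [hke]
  rw [Nat.cast_sum, Finset.sum_congr rfl fun e _ => hG e]
  rw [Fin.sum_univ_eq_sum_range G,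
    show Finset.range (2 * n) = Finset.range (k + M) by rw [h], Finset.sum_range_add, Finset.sum_eq_zero, zero_add]
  · simp [G]
  · intro e he
    simp only [G]
    rw [if_neg (not_le.2 (Finset.mem_range.1 he))]

lemma sum_range_descPochhammer (M k : ℕ) :
    ∑ r ∈ Finset.range M, ∏ i ∈ Finset.range k, ((r : ℝ) - i) =
      (∏ i ∈ Finset.range (k + 1), ((M : ℝ) - i)) / (k + 1) := by
  have hk : (k + 1 : ℝ) ≠ 0 := by positivity
  induction M with
  | zero =>
    rw [Finset.prod_eq_zero (Finset.mem_range.2 (Nat.succ_pos k)) (by simp)]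
    simp
  | succ M ih =>
    rw [Finset.sum_range_succ, ih, Finset.prod_range_succ, Finset.prod_range_succ' _ k]
    push_cast
    simp only [add_sub_add_right_eq_sub]
    field_simp
    ring

/-- `runFactor n k` is the ratio of the expected number of length-`k` windows of first occurrences
to `(2n+1)/(k+1)`. -/
noncomputable def runFactor (n k : ℕ) : ℝ :=
  ∏ i ∈ Finset.range k, ((2 * n - 2 * i : ℝ) / (2 * n + 1 - i))

lemma runFactor_succ (n k : ℕ) :
    runFactor n (k + 1) = runFactor n k * ((2 * n - 2 * k) / (2 * n + 1 - k)) :=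
  Finset.prod_range_succ _ _

lemma runFactor_eq_zero {n k : ℕ} (h : n < k) : runFactor n k = 0 :=
  Finset.prod_eq_zero (Finset.mem_range.2 h) (by simp)

lemma prod_range_eq_runFactor {n k : ℕ} (h : k ≤ 2 * n) :
    ∏ i ∈ Finset.range (k + 1), ((2 * n + 1 - k : ℝ) - i) =
      (2 * n + 1) * runFactor n k * ∏ i ∈ Finset.range k, (2 * n - 1 - 2 * i : ℝ) := by
  induction k with
  | zero => simp [runFactor]
  | succ k ih =>
    have hk : (2 * n + 1 - k : ℝ) ≠ 0 := by
      have : (k : ℝ) + 1 ≤ 2 * n := by exact_mod_cast h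
      linarith
    have h1 := Finset.prod_range_succ' (fun i : ℕ => (2 * n + 1 - k : ℝ) - i) (k + 2)
    rw [Finset.prod_range_succ, Finset.prod_range_succ, ih (by omega)] at h1
    have h2 : ∏ i ∈ Finset.range (k + 1 + 1), ((2 * n + 1 - (k + 1 : ℕ) : ℝ) - i) =
        ∏ i ∈ Finset.range (k + 2), ((2 * n + 1 - k : ℝ) - (i + 1 : ℕ)) :=
      Finset.prod_congr rfl fun i _ => by push_cast; ring
    rw [h2, Finset.prod_range_succ _ k, runFactor_succ]
    push_cast at h1 ⊢
    field_simp
    linear_combination -h1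

lemma sum_firstsProb (n k M : ℕ) :
    ∑ r ∈ Finset.range M, firstsProb n k r = (∏ i ∈ Finset.range (k + 1), ((M : ℝ) - i)) /
      (k + 1) / ∏ i ∈ Finset.range k, (2 * n - 1 - 2 * i : ℝ) := by
  simp_rw [firstsProb, Finset.prod_div_distrib]
  rw [← Finset.sum_div, sum_range_descPochhammer]

lemma sum_range_firstsProb {n k : ℕ} (h : k ≤ 2 * n) :
    ∑ r ∈ Finset.range (2 * n + 1 - k), firstsProb n k r =
      (2 * n + 1) * runFactor n k / (k + 1) := by
  rw [sum_firstsProb, Nat.cast_sub (by omega)]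
  push_cast
  rw [prod_range_eq_runFactor h]
  have := Finset.prod_ne_zero_iff.2 fun i (_ : i ∈ Finset.range k) => odd_sub_ne_zero n i
  field_simp

lemma mean_countP_blockLens {n k : ℕ} (hn : 1 ≤ n) (hk : 1 ≤ k) :
    ((∑ π ∈ deals n, (blockLens π).countP (fun b => decide (k < b)) : ℕ) : ℝ) / (deals n).card =
      (2 * n + 1) * runFactor n k / (k + 1) - (2 * n + 1) * runFactor n (k + 1) / (k + 2) := by
  have hD : ((deals n).card : ℝ) ≠ 0 := by
    exact_mod_cast (Finset.card_pos.2 (deals_nonempty n)).ne'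
  rcases Nat.lt_or_ge k (2 * n) with hkn | hkn
  · obtain ⟨M, hM⟩ := Nat.exists_eq_add_of_le hkn.le
    have hMr : (2 * n : ℝ) = k + M := by exact_mod_cast hM
    have h1 := sum_range_firstsProb hkn.le
    have h2 := sum_range_firstsProb (Nat.succ_le_of_lt hkn)
    rw [show 2 * n + 1 - k = M + 1 by omega, Finset.sum_range_succ',
      show firstsProb n k ((0 : ℕ) : ℝ) = 0 from
        Finset.prod_eq_zero (Finset.mem_range.2 hk) (by simp), add_zero] at h1
    rw [show 2 * n + 1 - k.succ = M by omega] at h2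
    rw [sum_countP_blockLens hM.symm, div_eq_iff hD, Finset.sum_sub_distrib,
      ← Finset.sum_range_reflect, ← Finset.sum_range_reflect fun s =>
        ((firstsFrom n s (k + 1)).card : ℝ)]
    have e1 : ∀ j ∈ Finset.range M, ((firstsFrom n (M - 1 - j) k).card : ℝ) =
        (deals n).card * firstsProb n k (j + 1 : ℕ) := fun j hj => by
      have hj := Finset.mem_range.1 hj
      rw [card_firstsFrom (by omega), hMr, Nat.sub_sub, Nat.cast_sub (by omega)]
      push_cast; congr 2; ring
    have e2 : ∀ j ∈ Finset.range M, ((firstsFrom n (M - 1 - j) (k + 1)).card : ℝ) =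
        (deals n).card * firstsProb n (k + 1) j := fun j hj => by
      have hj := Finset.mem_range.1 hj
      rw [card_firstsFrom (by omega), hMr, Nat.sub_sub, Nat.cast_sub (by omega)]
      push_cast; congr 2; ring
    rw [Finset.sum_congr rfl e1, Finset.sum_congr rfl e2, ← Finset.mul_sum, ← Finset.mul_sum,
      h1, h2]
    push_cast; ring
  · rw [runFactor_eq_zero (by omega), runFactor_eq_zero (by omega), Finset.sum_eq_zero]
    · simp
    · intro π _
      rw [countP_blockLens, Finset.card_eq_zero, Finset.filter_eq_empty_iff]
      rintro e - ⟨h, -⟩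
      omega

lemma eb_succ {n j : ℕ} (hn : 1 ≤ n) (hj : 1 ≤ j) :
    eb n (j + 1) = (2 * n + 1) * (runFactor n j / (j + 1) - 2 * (runFactor n (j + 1) / (j + 2)) +
      runFactor n (j + 2) / (j + 3)) := by
  have h1 := mean_countP_blockLens hn hj
  have h2 := mean_countP_blockLens hn (Nat.le_succ_of_le hj)
  simp_rw [countP_lt_eq_count_add j, Finset.sum_add_distrib, Nat.cast_add, add_div] at h1
  push_cast at h1 h2
  rw [h2] at h1
  rw [eb, bcount]
  push_cast
  linear_combination h1

lemma runFactor_nonneg (n k : ℕ) : 0 ≤ runFactor n k := by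
  rcases Nat.lt_or_ge n k with h | h
  · rw [runFactor_eq_zero h]
  · refine Finset.prod_nonneg fun i hi => ?_
    have : (i : ℝ) + 1 ≤ n := by
      have := Finset.mem_range.1 hi
      exact_mod_cast (by omega : i + 1 ≤ n)
    exact div_nonneg (by linarith) (by linarith)

lemma runFactor_le_exp (n k : ℕ) :
    runFactor n k ≤ Real.exp (-(k * (k + 1) / (2 * (2 * n + 1)))) := by
  induction k with
  | zero => simp [runFactor]
  | succ k ih =>
    rcases Nat.lt_or_ge n (k + 1) with h | h
    · rw [runFactor_eq_zero h]; positivity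
    · have hk : (k : ℝ) + 1 ≤ n := by exact_mod_cast h
      have hk0 : (0 : ℝ) ≤ k := k.cast_nonneg
      have hd : (0 : ℝ) < 2 * n + 1 - k := by linarith
      have h1 : (2 * n - 2 * k : ℝ) / (2 * n + 1 - k) ≤ Real.exp (-((k + 1) / (2 * n + 1))) := by
        have h2 : (2 * n - 2 * k : ℝ) / (2 * n + 1 - k) ≤ -((k + 1) / (2 * n + 1)) + 1 := by
          have h3 : (2 * n - 2 * k : ℝ) / (2 * n + 1 - k) = -((k + 1) / (2 * n + 1 - k)) + 1 := by
            field_simp; ring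
          rw [h3]
          gcongr
          linarith
        exact h2.trans (Real.add_one_le_exp _)
      rw [runFactor_succ]
      calc _ ≤ Real.exp (-(k * (k + 1) / (2 * (2 * n + 1)))) *
              Real.exp (-((k + 1) / (2 * n + 1))) :=
            mul_le_mul ih h1 (div_nonneg (by linarith) hd.le) (Real.exp_pos _).le
        _ = _ := by
            rw [← Real.exp_add]; congr 1; push_cast; field_simp; ring

lemma runFactor_mul_le_one (n k : ℕ) : runFactor n k *
    (1 + k * (k + 1) / (2 * (2 * n + 1)) + (k * (k + 1) / (2 * (2 * n + 1))) ^ 2 / 2) ≤ 1 := by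
  set x : ℝ := k * (k + 1) / (2 * (2 * n + 1)) with hx
  have hx0 : 0 ≤ x := by positivity
  calc _ ≤ Real.exp (-x) * Real.exp x :=
        mul_le_mul (runFactor_le_exp n k) (Real.quadratic_le_exp_of_nonneg hx0) (by positivity)
          (Real.exp_pos _).le
    _ = 1 := by rw [← Real.exp_add]; simp

lemma runFactor_le_one (n k : ℕ) : runFactor n k ≤ 1 :=
  (runFactor_le_exp n k).trans (Real.exp_le_one_iff.2 (neg_nonpos.2 (by positivity)))

lemma runFactor_mul_sq_le (n k : ℕ) : runFactor n k * (k + 1) ^ 2 ≤ 5 * (2 * n + 1) := by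
  have h := runFactor_mul_le_one n k
  have h0 := runFactor_nonneg n k
  have h1 := runFactor_le_one n k
  have hm : (1 : ℝ) ≤ 2 * n + 1 := by have := n.cast_nonneg (α := ℝ); linarith
  have hx : (k : ℝ) * (k + 1) = 2 * (2 * n + 1) * (k * (k + 1) / (2 * (2 * n + 1))) := by field_simp
  set x : ℝ := k * (k + 1) / (2 * (2 * n + 1))
  have hx2 : runFactor n k * x ≤ 1 := by nlinarith [mul_nonneg h0 (sq_nonneg x)]
  nlinarith [mul_nonneg h0 (sq_nonneg (k : ℝ))]

lemma runFactor_mul_pow_four_le (n k : ℕ) :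
    runFactor n k * (k + 1) ^ 4 ≤ 41 * (2 * n + 1) ^ 2 := by
  have h := runFactor_mul_le_one n k
  have h0 := runFactor_nonneg n k
  have h1 := runFactor_le_one n k
  have hm : (1 : ℝ) ≤ 2 * n + 1 := by have := n.cast_nonneg (α := ℝ); linarith
  have hk0 : (0 : ℝ) ≤ k := k.cast_nonneg
  have hx0 : (0 : ℝ) ≤ k * (k + 1) / (2 * (2 * n + 1)) := by positivity
  have hx : (k : ℝ) * (k + 1) = 2 * (2 * n + 1) * (k * (k + 1) / (2 * (2 * n + 1))) := by field_simp
  set x : ℝ := k * (k + 1) / (2 * (2 * n + 1))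
  set m : ℝ := 2 * n + 1
  have hx1 : runFactor n k * x ≤ 1 := by nlinarith [mul_nonneg h0 (sq_nonneg x)]
  have hx2 : runFactor n k * x ^ 2 ≤ 2 := by nlinarith [mul_nonneg h0 hx0]
  have h4 : ((k : ℝ) + 1) ^ 4 ≤ (4 * m * x + 1) ^ 2 := by
    have : ((k : ℝ) + 1) ^ 2 ≤ 4 * m * x + 1 := by nlinarith
    calc ((k : ℝ) + 1) ^ 4 = ((k + 1) ^ 2) ^ 2 := by ring
      _ ≤ _ := by gcongr
  calc runFactor n k * (k + 1) ^ 4 ≤ runFactor n k * (4 * m * x + 1) ^ 2 := by gcongr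
    _ = 16 * m ^ 2 * (runFactor n k * x ^ 2) + 8 * m * (runFactor n k * x) + runFactor n k := by
        ring
    _ ≤ 16 * m ^ 2 * 2 + 8 * m * 1 + 1 := by gcongr
    _ ≤ 41 * m ^ 2 := by nlinarith

/-- The scaled decrement of `runFactor`. -/
noncomputable def runDecr (n k : ℕ) : ℝ := (2 * n + 1) * (runFactor n k - runFactor n (k + 1))

lemma runDecr_eq_zero {n k : ℕ} (h : n < k) : runDecr n k = 0 := by
  rw [runDecr, runFactor_eq_zero h, runFactor_eq_zero (by omega)]; simp

lemma runDecr_eq {n k : ℕ} (h : k ≤ 2 * n) :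
    runDecr n k = runFactor n k * (k + 1) * ((2 * n + 1) / (2 * n + 1 - k)) := by
  have hk : (k : ℝ) ≤ 2 * n := by exact_mod_cast h
  have hd : (2 * n + 1 - k : ℝ) ≠ 0 := by linarith
  rw [runDecr, runFactor_succ]
  field_simp; ring

lemma runDecr_nonneg (n k : ℕ) : 0 ≤ runDecr n k := by
  rcases Nat.lt_or_ge n k with h | h
  · rw [runDecr_eq_zero h]
  · rw [runDecr_eq (by omega)]
    have hk : (k : ℝ) ≤ n := by exact_mod_cast h
    have : (0 : ℝ) ≤ 2 * n + 1 - k := by linarith [n.cast_nonneg (α := ℝ)]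
    have := runFactor_nonneg n k
    positivity

lemma runDecr_le (n k : ℕ) : runDecr n k ≤ 2 * (k + 1) := by
  rcases Nat.lt_or_ge n k with h | h
  · rw [runDecr_eq_zero h]; positivity
  · rw [runDecr_eq (by omega)]
    have hk : (k : ℝ) ≤ n := by exact_mod_cast h
    have hn : (0 : ℝ) ≤ n := n.cast_nonneg
    have h1 : ((2 * n + 1) / (2 * n + 1 - k) : ℝ) ≤ 2 := by
      rw [div_le_iff₀] <;> linarith
    have h2 : (0 : ℝ) ≤ (2 * n + 1) / (2 * n + 1 - k) := div_nonneg (by linarith) (by linarith)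
    have h3 : runFactor n k * (k + 1) ≤ 1 * (k + 1) := by
      have := runFactor_le_one n k
      gcongr
    have h4 : 0 ≤ runFactor n k * (k + 1) := mul_nonneg (runFactor_nonneg n k) (by positivity)
    nlinarith

lemma abs_runDecr_diff_le {n : ℕ} (hn : 2 ≤ n) (k : ℕ) :
    |runDecr n (k + 1) - runDecr n k| ≤ 96 := by
  rcases Nat.lt_or_ge n k with h | h
  · rw [runDecr_eq_zero h, runDecr_eq_zero (by omega)]; norm_num
  · have hk : (k : ℝ) ≤ n := by exact_mod_cast h
    have hn' : (2 : ℝ) ≤ n := by exact_mod_cast hn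
    have hk0 : (0 : ℝ) ≤ k := k.cast_nonneg
    have hc := runFactor_nonneg n k
    have hc1 := runFactor_le_one n k
    have hc2 := runFactor_mul_sq_le n k
    have hd1 : (0 : ℝ) < 2 * n + 1 - k := by linarith
    have hd2 : (0 : ℝ) < 2 * n - k := by linarith
    have e : runDecr n (k + 1) - runDecr n k = runFactor n k * (2 * n - k ^ 2 - 3 * k) *
        ((2 * n + 1) / ((2 * n + 1 - k) * (2 * n - k))) := by
      rw [runDecr_eq (k := k + 1) (by omega), runDecr_eq (k := k) (by omega), runFactor_succ]
      push_cast
      rw [show (2 * n + 1 - (k + 1) : ℝ) = 2 * n - k by ring]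
      field_simp
      ring
    have h1 : (2 * n + 1) / ((2 * n + 1 - k) * (2 * n - k)) ≤ (6 / (2 * n + 1) : ℝ) := by
      rw [div_le_div_iff₀ (by positivity) (by positivity)]
      nlinarith
    have h2 : |runFactor n k * (2 * n - k ^ 2 - 3 * k)| ≤ 16 * (2 * n + 1 : ℝ) := by
      rw [abs_le]
      constructor <;> nlinarith [mul_nonneg hc hk0, mul_nonneg hc (sq_nonneg (k : ℝ))]
    rw [e, abs_mul, abs_of_nonneg (a := (2 * n + 1 : ℝ) / ((2 * n + 1 - k) * (2 * n - k)))
      (by positivity)]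
    calc _ ≤ 16 * (2 * n + 1) * (6 / (2 * n + 1) : ℝ) := by gcongr
      _ = 96 := by field_simp; norm_num

lemma abs_runDecr_diff_two_le {n : ℕ} (hn : 2 ≤ n) (k : ℕ) :
    (k + 1) * |runDecr n (k + 2) - 2 * runDecr n (k + 1) + runDecr n k| ≤ 7830 := by
  rcases Nat.lt_or_ge n k with h | h
  · rw [runDecr_eq_zero h, runDecr_eq_zero (by omega), runDecr_eq_zero (by omega)]; norm_num
  · have hk : (k : ℝ) ≤ n := by exact_mod_cast h
    have hn' : (2 : ℝ) ≤ n := by exact_mod_cast hn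
    have hk0 : (0 : ℝ) ≤ k := k.cast_nonneg
    have hc := runFactor_nonneg n k
    have hc2 := runFactor_mul_sq_le n k
    have hc4 := runFactor_mul_pow_four_le n k
    have hd1 : (0 : ℝ) < 2 * n + 1 - k := by linarith
    have hd2 : (0 : ℝ) < 2 * n - k := by linarith
    have hd3 : (0 : ℝ) < 2 * n - 1 - k := by linarith
    have e : runDecr n (k + 2) - 2 * runDecr n (k + 1) + runDecr n k =
        runFactor n k * (k ^ 3 + 6 * k ^ 2 + 8 * k + 3 - 3 * (k + 1) * (2 * n + 1)) *
        ((2 * n + 1) / ((2 * n + 1 - k) * (2 * n - k) * (2 * n - 1 - k))) := by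
      rw [runDecr_eq (k := k + 2) (by omega), runDecr_eq (k := k + 1) (by omega),
        runDecr_eq (k := k) (by omega), runFactor_succ n (k + 1), runFactor_succ]
      push_cast
      rw [show (2 * n + 1 - (k + 1) : ℝ) = 2 * n - k by ring,
        show (2 * n + 1 - (k + 2) : ℝ) = 2 * n - 1 - k by ring]
      field_simp
      ring
    have h1 : (2 * n + 1) / ((2 * n + 1 - k) * (2 * n - k) * (2 * n - 1 - k)) ≤
        (30 / (2 * n + 1) ^ 2 : ℝ) := by
      rw [div_le_div_iff₀ (by positivity) (by positivity)]
      have a1 : (2 * n + 1 : ℝ) ≤ 2 * (2 * n + 1 - k) := by linarith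
      have a2 : (2 * n + 1 : ℝ) ≤ 3 * (2 * n - k) := by linarith
      have a3 : (2 * n + 1 : ℝ) ≤ 5 * (2 * n - 1 - k) := by linarith
      calc (2 * n + 1 : ℝ) * (2 * n + 1) ^ 2 = (2 * n + 1) * (2 * n + 1) * (2 * n + 1) := by ring
        _ ≤ 2 * (2 * n + 1 - k) * (3 * (2 * n - k)) * (5 * (2 * n - 1 - k)) := by gcongr
        _ = _ := by ring
    have h2 : |(k : ℝ) ^ 3 + 6 * k ^ 2 + 8 * k + 3 - 3 * (k + 1) * (2 * n + 1)| ≤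
        (3 * (k + 1) * (2 * n + 1) + 6 * (k + 1) ^ 3 : ℝ) := by
      rw [abs_le]
      constructor
      · have : (0 : ℝ) ≤ k ^ 3 + 6 * k ^ 2 + 8 * k + 3 + 6 * (k + 1) ^ 3 := by positivity
        linarith
      · have : (0 : ℝ) ≤ 3 * (k + 1) * (2 * n + 1) := by positivity
        have : (0 : ℝ) ≤ k ^ 3 := by positivity
        nlinarith [sq_nonneg (k : ℝ)]
    rw [e, abs_mul, abs_mul, abs_of_nonneg hc,
      abs_of_nonneg (a := (2 * n + 1 : ℝ) / ((2 * n + 1 - k) * (2 * n - k) * (2 * n - 1 - k)))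
      (by positivity)]
    calc _ ≤ (k + 1) * (runFactor n k * (3 * (k + 1) * (2 * n + 1) + 6 * (k + 1) ^ 3) *
          (30 / (2 * n + 1) ^ 2)) := by gcongr
      _ = (3 * (2 * n + 1) * (runFactor n k * (k + 1) ^ 2) + 6 * (runFactor n k * (k + 1) ^ 4)) *
          (30 / (2 * n + 1) ^ 2) := by ring
      _ ≤ (3 * (2 * n + 1) * (5 * (2 * n + 1)) + 6 * (41 * (2 * n + 1) ^ 2)) *
          (30 / (2 * n + 1) ^ 2) := by gcongr
      _ = 7830 := by field_simp; norm_num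

/-- The deficit of the expected number of length-`k` windows of first occurrences with respect to
`(2n+1)/(k+1)`. -/
noncomputable def runDeficit (n k : ℕ) : ℝ := (2 * n + 1) * (1 - runFactor n k) / (k + 1)

lemma runDeficit_mul (n k : ℕ) : (k + 1) * runDeficit n k = (2 * n + 1) * (1 - runFactor n k) := by
  rw [runDeficit]; field_simp

lemma runDeficit_rec (n k : ℕ) :
    (k + 2) * (runDeficit n (k + 1) - runDeficit n k) + runDeficit n k = runDecr n k := by
  have h1 := runDeficit_mul n k
  have h2 := runDeficit_mul n (k + 1)
  push_cast at h2
  rw [runDecr]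
  linear_combination h2 - h1

lemma runDeficit_nonneg (n k : ℕ) : 0 ≤ runDeficit n k := by
  have := runFactor_le_one n k
  have : 0 ≤ 1 - runFactor n k := by linarith
  rw [runDeficit]; positivity

lemma runDeficit_le (n k : ℕ) : runDeficit n k ≤ k := by
  induction k with
  | zero => simp [runDeficit, runFactor]
  | succ k ih =>
    have h1 := runDeficit_rec n k
    have h2 := runDecr_le n k
    have hk : (0 : ℝ) < k + 2 := by positivity
    push_cast
    refine le_of_mul_le_mul_left ?_ hk
    nlinarith

lemma abs_runDeficit_diff_three_le {n : ℕ} (hn : 2 ≤ n) (k : ℕ) :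
    |runDeficit n (k + 3) - 3 * runDeficit n (k + 2) + 3 * runDeficit n (k + 1) - runDeficit n k| ≤
      9000 / ((k : ℝ) + 1) ^ 2 := by
  have r0 := runDeficit_rec n k
  have r1 := runDeficit_rec n (k + 1)
  have r2 := runDeficit_rec n (k + 2)
  have hk0 : (0 : ℝ) ≤ k := k.cast_nonneg
  have hd0 := runDecr_nonneg n k
  have hd1 := runDecr_le n k
  have ha0 := runDeficit_nonneg n k
  have ha1 := runDeficit_le n k
  have hD1 := abs_runDecr_diff_le hn k
  have hD2 := abs_runDecr_diff_two_le hn k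
  simp only [add_assoc, Nat.reduceAdd] at r0 r1 r2
  push_cast at r0 r1 r2
  have hp2 : (0 : ℝ) < k + 2 := by positivity
  have hp3 : (0 : ℝ) < k + 3 := by positivity
  have hp4 : (0 : ℝ) < k + 4 := by positivity
  generalize runDeficit n k = a0 at *
  generalize runDeficit n (k + 1) = a1 at *
  generalize runDeficit n (k + 2) = a2 at *
  generalize runDeficit n (k + 3) = a3 at *
  generalize runDecr n k = d0 at *
  generalize runDecr n (k + 1) = d1 at *
  generalize runDecr n (k + 2) = d2 at *
  have b1 : |a1 - a0| ≤ 2 := by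
    rw [abs_le]
    constructor <;> refine le_of_mul_le_mul_left ?_ hp2 <;> nlinarith
  have b2 : (k + 3) * |a2 - 2 * a1 + a0| ≤ 100 := by
    rw [← abs_of_pos hp3, ← abs_mul, show (k + 3) * (a2 - 2 * a1 + a0) =
      (d1 - d0) - 2 * (a1 - a0) by linear_combination r1 - r0]
    rw [abs_le] at *
    constructor <;> linarith
  have b3 : (k + 1) * ((k + 4) * |a3 - 3 * a2 + 3 * a1 - a0|) ≤ 8130 := by
    rw [← abs_of_pos hp4, ← abs_mul, show (k + 4) * (a3 - 3 * a2 + 3 * a1 - a0) =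
      (d2 - 2 * d1 + d0) - 3 * (a2 - 2 * a1 + a0) by linear_combination r2 - 2 * r1 + r0]
    have t := abs_sub (d2 - 2 * d1 + d0) (3 * (a2 - 2 * a1 + a0))
    rw [abs_mul, abs_of_pos (three_pos (α := ℝ))] at t
    have := abs_nonneg (a2 - 2 * a1 + a0)
    nlinarith
  rw [le_div_iff₀ (by positivity)]
  nlinarith [abs_nonneg (a3 - 3 * a2 + 3 * a1 - a0)]

open Filter

lemma runDeficit_of_lt {n k : ℕ} (h : n < k) : runDeficit n k = (2 * n + 1) / (k + 1) := by
  rw [runDeficit, runFactor_eq_zero h, sub_zero, mul_one]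

lemma tendsto_two_mul_add_one_sub_atTop (k : ℝ) :
    Tendsto (fun n : ℕ => (2 * n + 1 - k : ℝ)) atTop atTop := by
  have h : Tendsto (fun n : ℕ => (2 * n : ℝ)) atTop atTop :=
    tendsto_natCast_atTop_atTop.const_mul_atTop two_pos
  simpa only [add_sub_assoc] using tendsto_atTop_add_const_right _ (1 - k) h

lemma tendsto_runFactor (k : ℕ) : Tendsto (fun n => runFactor n k) atTop (nhds 1) := by
  have h : Tendsto (fun n : ℕ => 1 - (k * (k + 1) : ℝ) / (2 * n + 1 - 0)) atTop (nhds (1 - 0)) :=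
    tendsto_const_nhds.sub (tendsto_const_nhds.div_atTop (tendsto_two_mul_add_one_sub_atTop 0))
  rw [sub_zero] at h
  refine tendsto_of_tendsto_of_tendsto_of_le_of_le h tendsto_const_nhds (fun n => ?_)
    fun n => runFactor_le_one n k
  have h1 := runDeficit_mul n k
  have h2 := runDeficit_le n k
  have hm : (0 : ℝ) < 2 * n + 1 := by positivity
  simp only [sub_zero]
  rw [sub_le_comm, le_div_iff₀ hm]
  nlinarith [k.cast_nonneg (α := ℝ)]

lemma tendsto_runDecr (k : ℕ) : Tendsto (fun n => runDecr n k) atTop (nhds (k + 1)) := by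
  have h : Tendsto (fun n : ℕ => runFactor n k * (k + 1) * (1 + k / (2 * n + 1 - k : ℝ))) atTop
      (nhds (1 * (k + 1) * (1 + 0))) :=
    ((tendsto_runFactor k).mul_const _).mul
      ((tendsto_const_nhds.div_atTop (tendsto_two_mul_add_one_sub_atTop k)).const_add 1)
  simp only [one_mul, add_zero, mul_one] at h
  refine h.congr' ?_
  filter_upwards [eventually_ge_atTop k] with n hn
  have hk : (k : ℝ) ≤ n := by exact_mod_cast hn
  have hd : (2 * n + 1 - k : ℝ) ≠ 0 := by linarith [n.cast_nonneg (α := ℝ)]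
  rw [runDecr_eq (by omega)]
  congr 1
  field_simp
  ring

lemma tendsto_runDeficit (k : ℕ) : Tendsto (fun n => runDeficit n k) atTop (nhds (k / 2)) := by
  induction k with
  | zero => simp [runDeficit, runFactor]
  | succ k ih =>
    have hk : (k + 2 : ℝ) ≠ 0 := by positivity
    have h := ih.add (((tendsto_runDecr k).sub ih).div_const (k + 2 : ℝ))
    have e : (k / 2 + (k + 1 - k / 2) / (k + 2) : ℝ) = (k + 1 : ℕ) / 2 := by
      push_cast; field_simp; ring
    rw [e] at h
    refine h.congr fun n => ?_
    rw [← runDeficit_rec n k]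
    field_simp
    ring

/-- The discrepancy `db n (j+1)`, extended to `j = 0`. -/
noncomputable def runDiscrepancy (n j : ℕ) : ℝ :=
  2 * runDeficit n (j + 1) - runDeficit n j - runDeficit n (j + 2)

lemma db_succ {n j : ℕ} (hn : 1 ≤ n) (hj : 1 ≤ j) : db n (j + 1) = runDiscrepancy n j := by
  rw [db, eb_succ hn hj, runDiscrepancy]
  simp only [runDeficit]
  push_cast
  field_simp
  ring

lemma summable_const_div_succ_sq (c : ℝ) : Summable fun k : ℕ => c / ((k : ℝ) + 1) ^ 2 := by
  have h := (summable_nat_add_iff 1).2 (Real.summable_one_div_nat_pow.2 one_lt_two)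
  push_cast at h
  simpa only [mul_one_div] using h.mul_left c

lemma summable_runDiscrepancy (n : ℕ) : Summable (runDiscrepancy n) := by
  refine Summable.of_norm_bounded_eventually_nat
    (summable_const_div_succ_sq (2 * (2 * n + 1))) ?_
  filter_upwards [eventually_gt_atTop n] with j hj
  rw [runDiscrepancy, runDeficit_of_lt hj, runDeficit_of_lt (by omega), runDeficit_of_lt (by omega)]
  push_cast
  have hj0 : (0 : ℝ) ≤ j := j.cast_nonneg
  have e : (2 * ((2 * n + 1) / (j + 1 + 1)) - (2 * n + 1) / (j + 1) - (2 * n + 1) / (j + 2 + 1) : ℝ)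
      = -(2 * (2 * n + 1) / ((j + 1) * (j + 2) * (j + 3))) := by
    field_simp; ring
  rw [e, norm_neg, Real.norm_of_nonneg (by positivity)]
  gcongr
  nlinarith

lemma tsum_runDiscrepancy (n : ℕ) : ∑' j, runDiscrepancy n j = 1 / 2 := by
  refine HasSum.tsum_eq ((summable_runDiscrepancy n).hasSum_iff_tendsto_nat.2 ?_)
  have hsum : ∀ N, ∑ j ∈ Finset.range N, runDiscrepancy n j =
      1 / 2 - (runDeficit n (N + 1) - runDeficit n N) := by
    intro N
    induction N with
    | zero =>
      have : (2 * n + 1 : ℝ) ≠ 0 := by positivity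
      simp only [Finset.range_zero, Finset.sum_empty, runDeficit, runFactor, zero_add,
        Finset.prod_range_one]
      push_cast
      field_simp
      ring
    | succ N ih => rw [Finset.sum_range_succ, ih, runDiscrepancy]; ring
  have ht : Tendsto (runDeficit n) atTop (nhds 0) := by
    have : Tendsto (fun k : ℕ => (2 * n + 1 : ℝ) / (k + 1)) atTop (nhds 0) :=
      tendsto_const_nhds.div_atTop
        (tendsto_atTop_add_const_right _ 1 tendsto_natCast_atTop_atTop)
    refine this.congr' ?_
    filter_upwards [eventually_gt_atTop n] with k hk
    rw [runDeficit_of_lt hk]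
  simp_rw [hsum]
  simpa using tendsto_const_nhds.sub (((tendsto_add_atTop_iff_nat 1).2 ht).sub ht)

lemma tendsto_tsum_runDiscrepancy_diff :
    Tendsto (fun n => ∑' i : ℕ, (runDiscrepancy n (2 * i) - runDiscrepancy n (2 * i + 1)))
      atTop (nhds 0) := by
  have e : ∀ n i : ℕ, runDiscrepancy n (2 * i) - runDiscrepancy n (2 * i + 1) =
      runDeficit n (2 * i + 3) - 3 * runDeficit n (2 * i + 2) + 3 * runDeficit n (2 * i + 1) -
        runDeficit n (2 * i) := fun n i => by
    simp only [runDiscrepancy, add_assoc, Nat.reduceAdd]; ring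
  rw [← tsum_zero (α := ℝ) (β := ℕ)]
  refine tendsto_tsum_of_dominated_convergence (summable_const_div_succ_sq 9000) (fun i => ?_) ?_
  · simp_rw [e]
    have := (((tendsto_runDeficit (2 * i + 3)).sub
      ((tendsto_runDeficit (2 * i + 2)).const_mul 3)).add
      ((tendsto_runDeficit (2 * i + 1)).const_mul 3)).sub (tendsto_runDeficit (2 * i))
    convert this using 2
    push_cast; ring
  · filter_upwards [eventually_ge_atTop 2] with n hn i
    rw [e]
    refine (abs_runDeficit_diff_three_le hn (2 * i)).trans ?_
    push_cast
    have : (0 : ℝ) ≤ i := i.cast_nonneg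
    gcongr
    linarith

/-- For each `n ≥ 1` the series `∑_{i=1}^∞ db(n,2i)` converges, and its sum
tends to `1/4` as `n → ∞`. -/
theorem tendsto_sum_db_even :
    (∀ n : ℕ, 1 ≤ n → Summable (fun i : ℕ => db n (2*(i+1)))) ∧
    Tendsto (fun n : ℕ => ∑' i : ℕ, db n (2*(i+1))) atTop (nhds (1/4)) := by
  have hdb : ∀ n, 1 ≤ n →
      (fun i : ℕ => db n (2*(i+1))) = fun i => runDiscrepancy n (2 * i + 1) :=
    fun n hn => funext fun i => db_succ hn (by omega)
  have hodd : ∀ n, Summable fun i => runDiscrepancy n (2 * i + 1) := fun n =>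
    (summable_runDiscrepancy n).comp_injective fun i j h => by simpa using h
  have heven : ∀ n, Summable fun i => runDiscrepancy n (2 * i) := fun n =>
    (summable_runDiscrepancy n).comp_injective fun i j h => by simpa using h
  refine ⟨fun n hn => hdb n hn ▸ hodd n, ?_⟩
  have h := (tendsto_tsum_runDiscrepancy_diff.const_mul (1 / 2)).const_sub (1 / 4)
  rw [mul_zero, sub_zero] at h
  refine h.congr' ?_
  filter_upwards [eventually_ge_atTop 1] with n hn
  have h1 := tsum_even_add_odd (heven n) (hodd n)
  rw [tsum_runDiscrepancy] at h1
  rw [hdb n hn, (heven n).tsum_sub (hodd n)]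
  linarith
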